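/- Let J be the superalgebra (2,2)₈. A bilinear map h : J × J → J is a supersymmetric 2-cocycle if and only if there exist α, β, δ, λ, ω, η, σ, τ, ρ, π, ν, κ ∈ F such that h(e₁,e₁) = αe₁ + βe₂ + ωf₂, h(e₁,e₂) = −ηe₁ − βe₂ + σf₁, h(e₁,f₁) = δe₂ + ½αf₁ + ρf₂, h(e₁,f₂) = πf₁, h(e₂,e₂) = ηe₁ + λe₂ − 2σf₁ + τf₂, h(e₂,f₁) = −2δe₂ − ½ηf₁, h(e₂,f₂) = νe₂, h(f₁,f₂) = κf₁, h(f₁,f₁) = h(f₂,f₂) = 0, with the remaining basis values determined by supersymmetry (h(e₂,e₁) = h(e₁,e₂), h(fⱼ,eᵢ) = h(eᵢ,fⱼ), h(f₂,f₁) = −h(f₁,f₂)). -/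

import Mathlib

namespace JS22

variable (F : Type*) [Field F] [CharZero F]

/-- The underlying ℤ₂-graded vector space `J = F⁴`: coordinates `0,1` are the even
basis vectors `e₁, e₂` and coordinates `2,3` are the odd basis vectors `f₁, f₂`. -/
abbrev J : Type _ := Fin 4 → F

def e1 : J F := ![1, 0, 0, 0]
def e2 : J F := ![0, 1, 0, 0]
def f1 : J F := ![0, 0, 1, 0]
def f2 : J F := ![0, 0, 0, 1]

/-- The even part `J₀ = span {e₁, e₂}`. -/
def J0 : Submodule F (J F) := Submodule.span F {e1 F, e2 F}

/-- The odd part `J₁ = span {f₁, f₂}`. -/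
def J1 : Submodule F (J F) := Submodule.span F {f1 F, f2 F}

/-- `x` is homogeneous of degree `d ∈ {0, 1}`. -/
def IsHomog (x : J F) (d : ℕ) : Prop :=
  (d = 0 ∧ x ∈ J0 F) ∨ (d = 1 ∧ x ∈ J1 F)

/-- A (bilinear) multiplication is supercommutative: `x y = (−1)^{|x||y|} y x`. -/
def IsSuperComm (mul : J F → J F → J F) : Prop :=
  ∀ x y : J F, ∀ dx dy : ℕ, IsHomog F x dx → IsHomog F y dy →
    mul x y = ((-1 : F) ^ (dx * dy)) • mul y x

/-- The Jordan superidentity, for all homogeneous `w, x, y, z`. -/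
def SatisfiesJordanSuperId (mul : J F → J F → J F) : Prop :=
  ∀ w x y z : J F, ∀ dw dx dy dz : ℕ,
    IsHomog F w dw → IsHomog F x dx → IsHomog F y dy → IsHomog F z dz →
    mul (mul w x) (mul y z)
      + ((-1 : F) ^ (dx * dy)) • mul (mul w y) (mul x z)
      + ((-1 : F) ^ ((dx + dy) * dz)) • mul (mul w z) (mul x y)
      - ((-1 : F) ^ (dw * dx)) • mul x (mul w (mul y z))
      - ((-1 : F) ^ (dy * (dw + dx))) • mul y (mul w (mul x z))
      - ((-1 : F) ^ (dz * (dw + dx + dy))) • mul z (mul w (mul x y)) = 0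

/-- `F(a,b,c,d) = h((ab)c, d) + h(ab,c)·d + (h(a,b)·c)·d`. -/
def Fc (mul : J F → J F → J F) (h : J F →ₗ[F] J F →ₗ[F] J F) (a b c d : J F) : J F :=
  h (mul (mul a b) c) d + mul (h (mul a b) c) d + mul (mul (h a b) c) d

/-- `G(a,b,c,d) = h(ab, cd) + h(a,b)·(cd) + (ab)·h(c,d)`. -/
def Gc (mul : J F → J F → J F) (h : J F →ₗ[F] J F →ₗ[F] J F) (a b c d : J F) : J F :=
  h (mul a b) (mul c d) + mul (h a b) (mul c d) + mul (mul a b) (h c d)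

/-- Supersymmetry of `h`: `h(a,b) = (−1)^{|a||b|} h(b,a)` for homogeneous `a, b`. -/
def IsSuperSym (h : J F →ₗ[F] J F →ₗ[F] J F) : Prop :=
  ∀ a b : J F, ∀ da db : ℕ, IsHomog F a da → IsHomog F b db →
    h a b = ((-1 : F) ^ (da * db)) • h b a

/-- The 2-cocycle identity for `h` with respect to the multiplication `mul`. -/
def IsCocycleId (mul : J F → J F → J F) (h : J F →ₗ[F] J F →ₗ[F] J F) : Prop :=
  ∀ a b c d : J F, ∀ da db dc dd : ℕ,
    IsHomog F a da → IsHomog F b db → IsHomog F c dc → IsHomog F d dd →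
    Fc F mul h a b c d + ((-1 : F) ^ (db * (dc + dd) + dc * dd)) • Fc F mul h a d c b
      + ((-1 : F) ^ (da * (db + dc + dd) + dc * dd)) • Fc F mul h b d c a
    = Gc F mul h a b c d + ((-1 : F) ^ (db * dc)) • Gc F mul h a c b d
      + ((-1 : F) ^ (dd * (dc + db))) • Gc F mul h a d b c

/-- `h` is a supersymmetric 2-cocycle. -/
def IsSuperCocycle (mul : J F → J F → J F) (h : J F →ₗ[F] J F →ₗ[F] J F) : Prop :=
  IsSuperSym F h ∧ IsCocycleId F mul h

/-- `h` is a coboundary: `h(a,b) = a·μ(b) + μ(a)·b − μ(a·b)` for some linear `μ`. -/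
def IsCoboundary (mul : J F → J F → J F) (h : J F →ₗ[F] J F →ₗ[F] J F) : Prop :=
  ∃ μ : J F →ₗ[F] J F, ∀ a b : J F, h a b = mul a (μ b) + mul (μ a) b - μ (mul a b)

/-- The bilinear map `h` is even: `h(J_i × J_j) ⊆ J_{i+j}`. -/
def IsEvenBilin (h : J F →ₗ[F] J F →ₗ[F] J F) : Prop :=
  (∀ a ∈ J0 F, ∀ b ∈ J0 F, h a b ∈ J0 F) ∧
  (∀ a ∈ J0 F, ∀ b ∈ J1 F, h a b ∈ J1 F) ∧
  (∀ a ∈ J1 F, ∀ b ∈ J0 F, h a b ∈ J1 F) ∧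
  (∀ a ∈ J1 F, ∀ b ∈ J1 F, h a b ∈ J0 F)

/-- The linear map `μ` is even: `μ(J_i) ⊆ J_i`. -/
def IsEvenLin (μ : J F →ₗ[F] J F) : Prop :=
  (∀ a ∈ J0 F, μ a ∈ J0 F) ∧ (∀ a ∈ J1 F, μ a ∈ J1 F)

/-- `φ` is a graded algebra isomorphism from `(J, mulA)` onto `(J, mulB)`. -/
def IsGradedIso (mulA mulB : J F → J F → J F) (φ : J F → J F) : Prop :=
  IsLinearMap F φ ∧ Function.Bijective φ ∧
  φ '' (J0 F : Set (J F)) = (J0 F : Set (J F)) ∧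
  φ '' (J1 F : Set (J F)) = (J1 F : Set (J F)) ∧
  ∀ x y : J F, φ (mulA x y) = mulB (φ x) (φ y)

/-- `D_γ`: `e₁²=e₁`, `e₂²=e₂`, `eᵢfⱼ = ½fⱼ`, `f₁f₂ = e₁ + γe₂`. -/
def mulD (γ : F) (x y : J F) : J F :=
  ![x 0 * y 0 + (x 2 * y 3 - x 3 * y 2),
    x 1 * y 1 + γ * (x 2 * y 3 - x 3 * y 2),
    ((x 0 + x 1) * y 2 + x 2 * (y 0 + y 1)) / 2,
    ((x 0 + x 1) * y 3 + x 3 * (y 0 + y 1)) / 2]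

/-- `(2,2)₁`: `e₁²=e₁`, `e₂²=e₂`. -/
def mul1 (x y : J F) : J F :=
  ![x 0 * y 0, x 1 * y 1, 0, 0]

/-- `(2,2)₃`: `e₁²=e₁`, `e₂²=e₂`, `e₁f₁=½f₁`, `e₁f₂=½f₂`, `f₁f₂=e₁`. -/
def mul3 (x y : J F) : J F :=
  ![x 0 * y 0 + (x 2 * y 3 - x 3 * y 2), x 1 * y 1,
    (x 0 * y 2 + x 2 * y 0) / 2, (x 0 * y 3 + x 3 * y 0) / 2]

/-- `(2,2)₅`: `e₁²=e₁`, `e₂²=e₂`, `e₁f₁=f₁`, `e₁f₂=f₂`, `f₁f₂=e₁`. -/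
def mul5 (x y : J F) : J F :=
  ![x 0 * y 0 + (x 2 * y 3 - x 3 * y 2), x 1 * y 1,
    x 0 * y 2 + x 2 * y 0, x 0 * y 3 + x 3 * y 0]

/-- `(2,2)₇`: `e₁²=e₁`, `e₂²=e₂`, `eᵢfⱼ=½fⱼ`, `f₁f₂=e₂`. -/
def mul7 (x y : J F) : J F :=
  ![x 0 * y 0, x 1 * y 1 + (x 2 * y 3 - x 3 * y 2),
    ((x 0 + x 1) * y 2 + x 2 * (y 0 + y 1)) / 2,
    ((x 0 + x 1) * y 3 + x 3 * (y 0 + y 1)) / 2]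

/-- `(2,2)₈`: `e₁²=e₁`, `e₂²=e₂`, `e₁f₁=½f₁`. -/
def mul8 (x y : J F) : J F :=
  ![x 0 * y 0, x 1 * y 1, (x 0 * y 2 + x 2 * y 0) / 2, 0]

/-- `(2,2)₂₆`: `e₁²=e₁`, `e₁f₁=½f₁`, `e₁f₂=½f₂`, `f₁f₂=e₁+e₂`. -/
def mul26 (x y : J F) : J F :=
  ![x 0 * y 0 + (x 2 * y 3 - x 3 * y 2), x 2 * y 3 - x 3 * y 2,
    (x 0 * y 2 + x 2 * y 0) / 2, (x 0 * y 3 + x 3 * y 0) / 2]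

/-- `(2,2)₄₃`: `e₁²=e₁`, `e₁e₂=e₂`, `e₁f₁=f₁`, `e₁f₂=f₂`, `f₁f₂=e₁+e₂`. -/
def mul43 (x y : J F) : J F :=
  ![x 0 * y 0 + (x 2 * y 3 - x 3 * y 2),
    x 0 * y 1 + x 1 * y 0 + (x 2 * y 3 - x 3 * y 2),
    x 0 * y 2 + x 2 * y 0, x 0 * y 3 + x 3 * y 0]

/-- `(2,2)₅₂`: `e₁²=e₁`, `e₁e₂=½e₂`. -/
def mul52 (x y : J F) : J F :=
  ![x 0 * y 0, (x 0 * y 1 + x 1 * y 0) / 2, 0, 0]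

/-- `(2,2)₅₇`: `e₁²=e₁`, `e₁e₂=½e₂`, `e₁f₂=f₂`. -/
def mul57 (x y : J F) : J F :=
  ![x 0 * y 0, (x 0 * y 1 + x 1 * y 0) / 2, 0, x 0 * y 3 + x 3 * y 0]

/-- `(2,2)₆₀`: `e₁²=e₁`, `e₁e₂=½e₂`, `e₁f₁=½f₁`, `e₁f₂=½f₂`. -/
def mul60 (x y : J F) : J F :=
  ![x 0 * y 0, (x 0 * y 1 + x 1 * y 0) / 2,
    (x 0 * y 2 + x 2 * y 0) / 2, (x 0 * y 3 + x 3 * y 0) / 2]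

/-- `(2,2)₆₇`: `e₁²=e₁`, `e₁e₂=½e₂`, `e₁f₁=f₁`, `e₁f₂=f₂`. -/
def mul67 (x y : J F) : J F :=
  ![x 0 * y 0, (x 0 * y 1 + x 1 * y 0) / 2,
    x 0 * y 2 + x 2 * y 0, x 0 * y 3 + x 3 * y 0]



set_option linter.unusedSectionVars false
set_option linter.unusedSimpArgs false
set_option linter.unusedVariables false

theorem m11 : mul8 F (e1 F) (e1 F) = e1 F := by
  ext i; fin_cases i <;> simp [mul8, e1]
theorem m12 : mul8 F (e1 F) (e2 F) = 0 := by
  ext i; fin_cases i <;> simp [mul8, e1, e2]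
theorem m13 : mul8 F (e1 F) (f1 F) = (1 / 2 : F) • f1 F := by
  ext i; fin_cases i <;> simp [mul8, e1, f1]
theorem m14 : mul8 F (e1 F) (f2 F) = 0 := by
  ext i; fin_cases i <;> simp [mul8, e1, f2]
theorem m21 : mul8 F (e2 F) (e1 F) = 0 := by
  ext i; fin_cases i <;> simp [mul8, e1, e2]
theorem m22 : mul8 F (e2 F) (e2 F) = e2 F := by
  ext i; fin_cases i <;> simp [mul8, e2]
theorem m2f (x : J F) (h0 : x 0 = 0) (h1 : x 1 = 0) : mul8 F (e2 F) x = 0 := by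
  ext i; fin_cases i <;> simp [mul8, e2, h1]
theorem m23 : mul8 F (e2 F) (f1 F) = 0 := m2f F _ (by simp [f1]) (by simp [f1])
theorem m24 : mul8 F (e2 F) (f2 F) = 0 := m2f F _ (by simp [f2]) (by simp [f2])
theorem m_comm (x y : J F) : mul8 F x y = mul8 F y x := by
  ext i; fin_cases i <;> simp [mul8] <;> ring
theorem m31 : mul8 F (f1 F) (e1 F) = (1 / 2 : F) • f1 F := by rw [m_comm, m13]
theorem m41 : mul8 F (f2 F) (e1 F) = 0 := by rw [m_comm, m14]
theorem m32 : mul8 F (f1 F) (e2 F) = 0 := by rw [m_comm, m23]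
theorem m42 : mul8 F (f2 F) (e2 F) = 0 := by rw [m_comm, m24]
theorem m33 : mul8 F (f1 F) (f1 F) = 0 := by
  ext i; fin_cases i <;> simp [mul8, f1]
theorem m34 : mul8 F (f1 F) (f2 F) = 0 := by
  ext i; fin_cases i <;> simp [mul8, f1, f2]
theorem m43 : mul8 F (f2 F) (f1 F) = 0 := by
  ext i; fin_cases i <;> simp [mul8, f1, f2]
theorem m44 : mul8 F (f2 F) (f2 F) = 0 := by
  ext i; fin_cases i <;> simp [mul8, f2]
theorem mz (x : J F) : mul8 F 0 x = 0 := by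
  ext i; fin_cases i <;> simp [mul8]
theorem zm (x : J F) : mul8 F x 0 = 0 := by
  ext i; fin_cases i <;> simp [mul8]
theorem ms (c : F) (x y : J F) : mul8 F (c • x) y = c • mul8 F x y := by
  ext i; fin_cases i <;> simp [mul8] <;> ring
theorem sm (c : F) (x y : J F) : mul8 F x (c • y) = c • mul8 F x y := by
  ext i; fin_cases i <;> simp [mul8] <;> ring

theorem hom_e1 : IsHomog F (e1 F) 0 := Or.inl ⟨rfl, Submodule.subset_span (by simp)⟩
theorem hom_e2 : IsHomog F (e2 F) 0 := Or.inl ⟨rfl, Submodule.subset_span (by simp)⟩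
theorem hom_f1 : IsHomog F (f1 F) 1 := Or.inr ⟨rfl, Submodule.subset_span (by simp)⟩
theorem hom_f2 : IsHomog F (f2 F) 1 := Or.inr ⟨rfl, Submodule.subset_span (by simp)⟩

theorem hom_cases {x : J F} {d : ℕ} (hx : IsHomog F x d) :
    (d = 0 ∧ ∃ a b : F, x = ![a, b, 0, 0]) ∨ (d = 1 ∧ ∃ a b : F, x = ![0, 0, a, b]) := by
  rcases hx with ⟨hd, hx⟩ | ⟨hd, hx⟩
  · obtain ⟨a, b, rfl⟩ := Submodule.mem_span_pair.1 hx
    refine Or.inl ⟨hd, a, b, ?_⟩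
    ext i; fin_cases i <;> simp [e1, e2]
  · obtain ⟨a, b, rfl⟩ := Submodule.mem_span_pair.1 hx
    refine Or.inr ⟨hd, a, b, ?_⟩
    ext i; fin_cases i <;> simp [f1, f2]

theorem decomp (x : J F) : x = x 0 • e1 F + x 1 • e2 F + x 2 • f1 F + x 3 • f2 F := by
  ext i; fin_cases i <;> simp [e1, e2, f1, f2]

theorem expand (h : J F →ₗ[F] J F →ₗ[F] J F) (x y : J F) : h x y =
    x 0 • (y 0 • h (e1 F) (e1 F) + y 1 • h (e1 F) (e2 F) + y 2 • h (e1 F) (f1 F)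
      + y 3 • h (e1 F) (f2 F))
    + x 1 • (y 0 • h (e2 F) (e1 F) + y 1 • h (e2 F) (e2 F) + y 2 • h (e2 F) (f1 F)
      + y 3 • h (e2 F) (f2 F))
    + x 2 • (y 0 • h (f1 F) (e1 F) + y 1 • h (f1 F) (e2 F) + y 2 • h (f1 F) (f1 F)
      + y 3 • h (f1 F) (f2 F))
    + x 3 • (y 0 • h (f2 F) (e1 F) + y 1 • h (f2 F) (e2 F) + y 2 • h (f2 F) (f1 F)
      + y 3 • h (f2 F) (f2 F)) := by
  conv_lhs => rw [decomp F x, decomp F y]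
  simp only [map_add, map_smul, LinearMap.add_apply, LinearMap.smul_apply]
  module

theorem v0 (a b c d : F) : (![a, b, c, d] : J F) 0 = a := rfl
theorem v1 (a b c d : F) : (![a, b, c, d] : J F) 1 = b := rfl
theorem v2 (a b c d : F) : (![a, b, c, d] : J F) 2 = c := rfl
theorem v3 (a b c d : F) : (![a, b, c, d] : J F) 3 = d := rfl

theorem coords (x : J F) : ∃ a b c d : F, x = ![a, b, c, d] := by
  refine ⟨x 0, x 1, x 2, x 3, ?_⟩
  ext i; fin_cases i <;> simp

set_option maxHeartbeats 4000000 in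
/-- description of all supersymmetric 2-cocycles of `(2,2)₈`. -/
theorem cocycles_of_mul8 (h : J F →ₗ[F] J F →ₗ[F] J F) :
    IsSuperCocycle F (mul8 F) h ↔
    ∃ α β δ lam ω η σ τ ρ π ν κ : F,
      h (e1 F) (e1 F) = α • e1 F + β • e2 F + ω • f2 F ∧
      h (e1 F) (e2 F) = (-η) • e1 F - β • e2 F + σ • f1 F ∧
      h (e1 F) (f1 F) = δ • e2 F + (α / 2) • f1 F + ρ • f2 F ∧
      h (e1 F) (f2 F) = π • f1 F ∧
      h (e2 F) (e2 F) = η • e1 F + lam • e2 F - (2 * σ) • f1 F + τ • f2 F ∧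
      h (e2 F) (f1 F) = (-(2 * δ)) • e2 F - (η / 2) • f1 F ∧
      h (e2 F) (f2 F) = ν • e2 F ∧
      h (f1 F) (f2 F) = κ • f1 F ∧

      h (f1 F) (f1 F) = 0 ∧ h (f2 F) (f2 F) = 0 ∧
      h (e2 F) (e1 F) = h (e1 F) (e2 F) ∧
      h (f1 F) (e1 F) = h (e1 F) (f1 F) ∧ h (f2 F) (e1 F) = h (e1 F) (f2 F) ∧
      h (f1 F) (e2 F) = h (e2 F) (f1 F) ∧ h (f2 F) (e2 F) = h (e2 F) (f2 F) ∧
      h (f2 F) (f1 F) = - h (f1 F) (f2 F) := by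
  constructor
  · rintro ⟨hS, hC⟩
    have s01 := hS _ _ _ _ (hom_e2 F) (hom_e1 F)
    have s02 := hS _ _ _ _ (hom_f1 F) (hom_e1 F)
    have s03 := hS _ _ _ _ (hom_f2 F) (hom_e1 F)
    have s12 := hS _ _ _ _ (hom_f1 F) (hom_e2 F)
    have s13 := hS _ _ _ _ (hom_f2 F) (hom_e2 F)
    have s22 := hS _ _ _ _ (hom_f1 F) (hom_f1 F)
    have s23 := hS _ _ _ _ (hom_f2 F) (hom_f1 F)
    have s33 := hS _ _ _ _ (hom_f2 F) (hom_f2 F)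
    have c0000 := hC _ _ _ _ _ _ _ _ (hom_e1 F) (hom_e1 F) (hom_e1 F) (hom_e1 F)
    have c0001 := hC _ _ _ _ _ _ _ _ (hom_e1 F) (hom_e1 F) (hom_e1 F) (hom_e2 F)
    have c0002 := hC _ _ _ _ _ _ _ _ (hom_e1 F) (hom_e1 F) (hom_e1 F) (hom_f1 F)
    have c0003 := hC _ _ _ _ _ _ _ _ (hom_e1 F) (hom_e1 F) (hom_e1 F) (hom_f2 F)
    have c0011 := hC _ _ _ _ _ _ _ _ (hom_e1 F) (hom_e1 F) (hom_e2 F) (hom_e2 F)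
    have c0013 := hC _ _ _ _ _ _ _ _ (hom_e1 F) (hom_e1 F) (hom_e2 F) (hom_f2 F)
    have c0021 := hC _ _ _ _ _ _ _ _ (hom_e1 F) (hom_e1 F) (hom_f1 F) (hom_e2 F)
    have c0023 := hC _ _ _ _ _ _ _ _ (hom_e1 F) (hom_e1 F) (hom_f1 F) (hom_f2 F)
    have c0112 := hC _ _ _ _ _ _ _ _ (hom_e1 F) (hom_e2 F) (hom_e2 F) (hom_f1 F)
    have c1113 := hC _ _ _ _ _ _ _ _ (hom_e2 F) (hom_e2 F) (hom_e2 F) (hom_f2 F)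
    have c2002 := hC _ _ _ _ _ _ _ _ (hom_f1 F) (hom_e1 F) (hom_e1 F) (hom_f1 F)
    clear hS hC
    norm_num only [Nat.mul_zero, Nat.zero_mul, Nat.mul_one, pow_zero, pow_one, one_smul] at s01 s02 s03 s12 s13 s22 s23 s33
    simp only [Fc, Gc, m11, m12, m13, m14, m21, m22, m23, m24, m31, m32, m33, m34, m41, m42,
      m43, m44, mz, zm, ms, sm, map_zero, map_smul, LinearMap.zero_apply, LinearMap.smul_apply,
      s01, s02, s03, s12, s13, s23] at c0000 c0001 c0002 c0003 c0011 c0013 c0021 c0023 c0112 c1113 c2002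
    simp only [s01, s02, s03, s12, s13, s23]
    generalize h (e1 F) (e1 F) = H00 at *
    generalize h (e1 F) (e2 F) = H01 at *
    generalize h (e1 F) (f1 F) = H02 at *
    generalize h (e1 F) (f2 F) = H03 at *
    generalize h (e2 F) (e2 F) = H11 at *
    generalize h (e2 F) (f1 F) = H12 at *
    generalize h (e2 F) (f2 F) = H13 at *
    generalize h (f1 F) (f1 F) = H22 at *
    generalize h (f1 F) (f2 F) = H23 at *
    generalize h (f2 F) (f2 F) = H33 at *
    obtain ⟨a00, b00, c00, d00, rfl⟩ := coords F H00
    obtain ⟨a01, b01, c01, d01, rfl⟩ := coords F H01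
    obtain ⟨a02, b02, c02, d02, rfl⟩ := coords F H02
    obtain ⟨a03, b03, c03, d03, rfl⟩ := coords F H03
    obtain ⟨a11, b11, c11, d11, rfl⟩ := coords F H11
    obtain ⟨a12, b12, c12, d12, rfl⟩ := coords F H12
    obtain ⟨a13, b13, c13, d13, rfl⟩ := coords F H13
    obtain ⟨a22, b22, c22, d22, rfl⟩ := coords F H22
    obtain ⟨a23, b23, c23, d23, rfl⟩ := coords F H23
    obtain ⟨a33, b33, c33, d33, rfl⟩ := coords F H33
    have c0000_0 := congrFun c0000 0
    have c0000_1 := congrFun c0000 1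
    have c0000_2 := congrFun c0000 2
    have c0000_3 := congrFun c0000 3
    have c0001_0 := congrFun c0001 0
    have c0001_1 := congrFun c0001 1
    have c0001_2 := congrFun c0001 2
    have c0001_3 := congrFun c0001 3
    have c0002_0 := congrFun c0002 0
    have c0002_1 := congrFun c0002 1
    have c0002_2 := congrFun c0002 2
    have c0002_3 := congrFun c0002 3
    have c0003_0 := congrFun c0003 0
    have c0003_1 := congrFun c0003 1
    have c0003_2 := congrFun c0003 2
    have c0003_3 := congrFun c0003 3
    have c0011_0 := congrFun c0011 0
    have c0011_1 := congrFun c0011 1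
    have c0011_2 := congrFun c0011 2
    have c0011_3 := congrFun c0011 3
    have c0013_0 := congrFun c0013 0
    have c0013_1 := congrFun c0013 1
    have c0013_2 := congrFun c0013 2
    have c0013_3 := congrFun c0013 3
    have c0021_0 := congrFun c0021 0
    have c0021_1 := congrFun c0021 1
    have c0021_2 := congrFun c0021 2
    have c0021_3 := congrFun c0021 3
    have c0023_0 := congrFun c0023 0
    have c0023_1 := congrFun c0023 1
    have c0023_2 := congrFun c0023 2
    have c0023_3 := congrFun c0023 3
    have c0112_0 := congrFun c0112 0
    have c0112_1 := congrFun c0112 1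
    have c0112_2 := congrFun c0112 2
    have c0112_3 := congrFun c0112 3
    have c1113_0 := congrFun c1113 0
    have c1113_1 := congrFun c1113 1
    have c1113_2 := congrFun c1113 2
    have c1113_3 := congrFun c1113 3
    have c2002_0 := congrFun c2002 0
    have c2002_1 := congrFun c2002 1
    have c2002_2 := congrFun c2002 2
    have c2002_3 := congrFun c2002 3
    have s22_0 := congrFun s22 0
    have s22_1 := congrFun s22 1
    have s22_2 := congrFun s22 2
    have s22_3 := congrFun s22 3
    have s33_0 := congrFun s33 0
    have s33_1 := congrFun s33 1
    have s33_2 := congrFun s33 2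
    have s33_3 := congrFun s33 3
    clear s01 s02 s03 s12 s13 s22 s23 s33 c0000 c0001 c0002 c0003 c0011 c0013 c0021 c0023 c0112 c1113 c2002
    simp [mul8, e1, e2, f1, f2] at c0000_0 c0000_1 c0000_2 c0000_3 c0001_0 c0001_1 c0001_2 c0001_3 c0002_0 c0002_1 c0002_2 c0002_3 c0003_0 c0003_1 c0003_2 c0003_3 c0011_0 c0011_1 c0011_2 c0011_3 c0013_0 c0013_1 c0013_2 c0013_3 c0021_0 c0021_1 c0021_2 c0021_3 c0023_0 c0023_1 c0023_2 c0023_3 c0112_0 c0112_1 c0112_2 c0112_3 c1113_0 c1113_1 c1113_2 c1113_3 c2002_0 c2002_1 c2002_2 c2002_3 s22_0 s22_1 s22_2 s22_3 s33_0 s33_1 s33_2 s33_3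
    refine ⟨a00, b00, b02, b11, d00, -a01, c01, d11, d02, c03, b13, c23,
      ?_, ?_, ?_, ?_, ?_, ?_, ?_, ?_, ?_, ?_, ?_, ?_, ?_, ?_, ?_, ?_⟩
    all_goals first | trivial | skip
    all_goals ext i; fin_cases i <;> simp [e1, e2, f1, f2] <;> grind
  · rintro ⟨α, β, δ, lam, ω, η, σ, τ, ρ, π, ν, κ, h11, h12, h13, h14, h22, h23, h24, h34,
      h33, h44, h21, h31, h41, h32, h42, h43⟩
    have key : ∀ x y : J F, h x y = ![
        x 0 * y 0 * α - (x 0 * y 1 + x 1 * y 0) * η + x 1 * y 1 * η,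
        x 0 * y 0 * β - (x 0 * y 1 + x 1 * y 0) * β + (x 0 * y 2 + x 2 * y 0) * δ
          + x 1 * y 1 * lam - 2 * (x 1 * y 2 + x 2 * y 1) * δ + (x 1 * y 3 + x 3 * y 1) * ν,
        (x 0 * y 1 + x 1 * y 0) * σ + (x 0 * y 2 + x 2 * y 0) * (α / 2)
          + (x 0 * y 3 + x 3 * y 0) * π - x 1 * y 1 * (2 * σ)
          - (x 1 * y 2 + x 2 * y 1) * (η / 2) + (x 2 * y 3 - x 3 * y 2) * κ,
        x 0 * y 0 * ω + (x 0 * y 2 + x 2 * y 0) * ρ + x 1 * y 1 * τ] := by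
      intro x y
      rw [expand F h x y, h43, h42, h32, h41, h31, h21, h11, h12, h13, h14, h22, h23, h24, h34,
        h33, h44]
      ext i; fin_cases i <;> simp [e1, e2, f1, f2] <;> ring
    clear h11 h12 h13 h14 h22 h23 h24 h34 h33 h44 h21 h31 h41 h32 h42 h43
    constructor
    · intro a b da db ha hb
      rcases hom_cases F ha with ⟨rfl, a0, a1, rfl⟩ | ⟨rfl, a0, a1, rfl⟩ <;>
      rcases hom_cases F hb with ⟨rfl, b0, b1, rfl⟩ | ⟨rfl, b0, b1, rfl⟩ <;>
      (rw [key, key]; ext i; fin_cases i <;> simp [-mul_eq_mul_right_iff, -mul_eq_mul_left_iff] <;> ring)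
    · intro a b c d da db dc dd ha hb hc hd
      rcases hom_cases F ha with ⟨rfl, a0, a1, rfl⟩ | ⟨rfl, a0, a1, rfl⟩ <;>
      rcases hom_cases F hb with ⟨rfl, b0, b1, rfl⟩ | ⟨rfl, b0, b1, rfl⟩ <;>
      rcases hom_cases F hc with ⟨rfl, c0, c1, rfl⟩ | ⟨rfl, c0, c1, rfl⟩ <;>
      rcases hom_cases F hd with ⟨rfl, d0, d1, rfl⟩ | ⟨rfl, d0, d1, rfl⟩ <;>
      (simp only [Fc, Gc, key, mul8, v0, v1, v2, v3, mul_zero, zero_mul, add_zero, zero_add, sub_zero, zero_div]; ext i; fin_cases i <;> simp <;> ring)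

end JS22
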